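/- arXiv:2311.08763 — 4 statements merged into one kernel-verified Lean document; each statement's English description precedes it below -/
import Mathlib

section
/- Let E be a measurable space, p ∈ (0,1), α a finite measure on E, and let φ, θ : E → ℂ be bounded measurable. Then for every bounded measurable F : Conf(E) → ℂ and every finite configuration η, (k⁻(φ)(k⁺(θ)F))(η) − (k⁺(θ)(k⁻(φ)F))(η) = 2 (k⁰(conj(φ)·θ)F)(η), i.e., the commutator [k⁻(φ), k⁺(θ)] acts on F as multiplication composed operator 2k⁰(conj(φ)θ). -/
open MeasureTheory Complex

noncomputable section

variable {E : Type*}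

/-- Number of points of the finite configuration `η` lying in `B`, counted with multiplicity. -/
def confCount (η : Multiset E) (B : Set E) : ℕ :=
  @Multiset.countP E (fun x => x ∈ B) (Classical.decPred _) η

/-- Removal of one copy of the point `x` from the configuration `η`. -/
def confDel (η : Multiset E) (x : E) : Multiset E :=
  @Multiset.erase E (Classical.decEq E) η x

/-- The σ-algebra on the configuration space generated by the counting maps `η ↦ η(B)`,
`B` measurable. -/
instance confMeasurableSpace [MeasurableSpace E] : MeasurableSpace (Multiset E) :=
  MeasurableSpace.generateFrom
    {S | ∃ (B : Set E) (n : ℕ), MeasurableSet B ∧ S = {η | confCount η B = n}}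

/-- The raising operator `k⁺(φ)`. -/
def kplus (p : ℝ) (φ : E → ℂ) (F : Multiset E → ℂ) (η : Multiset E) : ℂ :=
  (Real.sqrt p : ℂ)⁻¹ * (η.map (fun x => φ x * F (confDel η x))).sum

/-- The lowering operator `k⁻(φ)`. -/
def kminus (p : ℝ) [MeasurableSpace E] (α : Measure E) (φ : E → ℂ) (F : Multiset E → ℂ)
    (η : Multiset E) : ℂ :=
  (Real.sqrt p : ℂ) * ((∫ x, (starRingEnd ℂ) (φ x) * F (x ::ₘ η) ∂α) +
    (η.map (fun x => (starRingEnd ℂ) (φ x) * F (x ::ₘ η))).sum)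

/-- The neutral operator `k⁰(φ)`. -/
def kzero [MeasurableSpace E] (α : Measure E) (φ : E → ℂ) (F : Multiset E → ℂ)
    (η : Multiset E) : ℂ :=
  F η * ((η.map φ).sum + (1 / 2 : ℂ) * ∫ x, φ x ∂α)

theorem measurable_multiset_cons [MeasurableSpace E] (η : Multiset E) :
    Measurable (fun x : E => x ::ₘ η) := by
  refine measurable_generateFrom ?_
  rintro S ⟨B, n, hB, rfl⟩
  classical
  have h : (fun x : E => x ::ₘ η) ⁻¹' {ζ | confCount ζ B = n}
      = {x | confCount η B + (if x ∈ B then 1 else 0) = n} := by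
    ext x
    simp only [confCount, Set.mem_preimage, Set.mem_ofPred_eq, Multiset.countP_cons]
  rw [h]
  have hm : Measurable (fun x : E => confCount η B + (if x ∈ B then 1 else 0)) :=
    measurable_const.add (Measurable.ite hB measurable_const measurable_const)
  exact hm (measurableSet_singleton n)

theorem integrable_multiset_sum_map [MeasurableSpace E] {ι : Type*} {α : Measure E}
    (s : Multiset ι) {f : ι → E → ℂ} (hf : ∀ i, Integrable (f i) α) :
    Integrable (fun x => (s.map (fun i => f i x)).sum) α := by
  induction s using Multiset.induction_on with
  | empty => simp
  | cons i s ih =>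
    simp only [Multiset.map_cons, Multiset.sum_cons]
    exact (hf i).add ih

theorem integral_multiset_sum_map [MeasurableSpace E] {ι : Type*} {α : Measure E}
    (s : Multiset ι) {f : ι → E → ℂ} (hf : ∀ i, Integrable (f i) α) :
    ∫ x, (s.map (fun i => f i x)).sum ∂α = (s.map (fun i => ∫ x, f i x ∂α)).sum := by
  induction s using Multiset.induction_on with
  | empty => simp
  | cons i s ih =>
    simp only [Multiset.map_cons, Multiset.sum_cons]
    rw [integral_add (hf i) (integrable_multiset_sum_map s hf), ih]

theorem confDel_cons_self (η : Multiset E) (x : E) : confDel (x ::ₘ η) x = η := by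
  classical
  simp [confDel]

theorem cons_confDel {η : Multiset E} {x : E} (hx : x ∈ η) : x ::ₘ confDel η x = η :=
  @Multiset.cons_erase E (Classical.decEq E) η x hx

theorem confDel_cons_of_mem {η : Multiset E} {y : E} (hy : y ∈ η) (x : E) :
    confDel (x ::ₘ η) y = x ::ₘ confDel η y := by
  conv_lhs => rw [← cons_confDel hy, Multiset.cons_swap, confDel_cons_self]

theorem sum_map_confDel_cons (θ : E → ℂ) (F : Multiset E → ℂ) (η : Multiset E) (x : E) :
    ((x ::ₘ η).map (fun y => θ y * F (confDel (x ::ₘ η) y))).sum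
      = θ x * F η + (η.map (fun y => θ y * F (x ::ₘ confDel η y))).sum := by
  rw [Multiset.map_cons, Multiset.sum_cons, confDel_cons_self]
  congr 2
  exact Multiset.map_congr rfl fun y hy => by rw [confDel_cons_of_mem hy]

theorem sum_map_eq_add_confDel (g : E → ℂ) {η : Multiset E} {y : E} (hy : y ∈ η) :
    (η.map g).sum = g y + ((confDel η y).map g).sum := by
  conv_lhs => rw [← cons_confDel hy, Multiset.map_cons, Multiset.sum_cons]

/-- the commutator relation `[k⁻(φ), k⁺(θ)] = 2 k⁰(conj(φ)·θ)`. -/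
theorem commutator_kminus_kplus [MeasurableSpace E] (p : ℝ) (hp : p ∈ Set.Ioo (0 : ℝ) 1)
    (α : Measure E) [IsFiniteMeasure α]
    (φ θ : E → ℂ) (hφ : Measurable φ) (hφb : ∃ C, ∀ x, ‖φ x‖ ≤ C)
    (hθ : Measurable θ) (hθb : ∃ C, ∀ x, ‖θ x‖ ≤ C)
    (F : Multiset E → ℂ) (hF : Measurable F) (hFb : ∃ C, ∀ η, ‖F η‖ ≤ C)
    (η : Multiset E) :
    kminus p α φ (kplus p θ F) η - kplus p θ (kminus p α φ F) η
      = 2 * kzero α (fun x => (starRingEnd ℂ) (φ x) * θ x) F η := by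
  have hq : (Real.sqrt p : ℂ) ≠ 0 := by
    exact_mod_cast (Real.sqrt_pos.mpr hp.1).ne'
  obtain ⟨A, hA⟩ := hφb
  obtain ⟨B, hB⟩ := hθb
  obtain ⟨C, hC⟩ := hFb
  have hφc : Measurable (fun x => (starRingEnd ℂ) (φ x)) :=
    Complex.continuous_conj.measurable.comp hφ
  have hφF : ∀ ζ : Multiset E,
      Integrable (fun x => (starRingEnd ℂ) (φ x) * F (x ::ₘ ζ)) α := fun ζ =>
    (Integrable.of_bound (hF.comp (measurable_multiset_cons ζ)).aestronglyMeasurable C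
      (.of_forall fun x => hC _)).bdd_mul hφc.aestronglyMeasurable
      (.of_forall fun x => by simpa using hA x)
  have hφθ : Integrable (fun x => (starRingEnd ℂ) (φ x) * θ x) α :=
    (Integrable.of_bound hθ.aestronglyMeasurable B (.of_forall hB)).bdd_mul
      hφc.aestronglyMeasurable (.of_forall fun x => by simpa using hA x)
  have hpoint : ∀ x, (starRingEnd ℂ) (φ x) * kplus p θ F (x ::ₘ η)
      = (Real.sqrt p : ℂ)⁻¹ * ((starRingEnd ℂ) (φ x) * θ x * F η
        + (η.map (fun y => θ y * ((starRingEnd ℂ) (φ x) * F (x ::ₘ confDel η y)))).sum) := by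
    intro x
    simp only [kplus, sum_map_confDel_cons, mul_left_comm (θ _) ((starRingEnd ℂ) (φ x)),
      Multiset.sum_map_mul_left]
    ring
  have hint : ∀ y, Integrable
      (fun x => θ y * ((starRingEnd ℂ) (φ x) * F (x ::ₘ confDel η y))) α :=
    fun y => (hφF _).const_mul _
  have hlower : kminus p α φ (kplus p θ F) η
      = (∫ x, (starRingEnd ℂ) (φ x) * θ x ∂α) * F η
        + (η.map (fun y => θ y * ∫ x, (starRingEnd ℂ) (φ x) * F (x ::ₘ confDel η y) ∂α)).sum
        + ((η.map (fun x => (starRingEnd ℂ) (φ x) * θ x)).sum * F η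
        + (η.map (fun y => θ y *
            (η.map (fun x => (starRingEnd ℂ) (φ x) * F (x ::ₘ confDel η y))).sum)).sum) := by
    simp only [kminus, hpoint]
    rw [integral_const_mul, Multiset.sum_map_mul_left, ← mul_add, mul_inv_cancel_left₀ hq,
      integral_add (hφθ.mul_const _) (integrable_multiset_sum_map η hint), integral_mul_const,
      integral_multiset_sum_map η hint, Multiset.sum_map_add, Multiset.sum_map_mul_right,
      Multiset.sum_map_sum_map]
    simp only [integral_const_mul, Multiset.sum_map_mul_left]
  have hraise : kplus p θ (kminus p α φ F) η
      = (η.map (fun y => θ y * ∫ x, (starRingEnd ℂ) (φ x) * F (x ::ₘ confDel η y) ∂α)).sum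
        + (η.map (fun y => θ y * ((confDel η y).map
            (fun x => (starRingEnd ℂ) (φ x) * F (x ::ₘ confDel η y))).sum)).sum := by
    simp only [kplus, kminus, mul_left_comm (θ _) (Real.sqrt p : ℂ)]
    rw [Multiset.sum_map_mul_left, inv_mul_cancel_left₀ hq]
    simp only [mul_add, Multiset.sum_map_add]
  have hdiag : (η.map (fun y => θ y *
        (η.map (fun x => (starRingEnd ℂ) (φ x) * F (x ::ₘ confDel η y))).sum)).sum
      = (η.map (fun x => (starRingEnd ℂ) (φ x) * θ x)).sum * F η
        + (η.map (fun y => θ y * ((confDel η y).map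
            (fun x => (starRingEnd ℂ) (φ x) * F (x ::ₘ confDel η y))).sum)).sum := by
    rw [← Multiset.sum_map_mul_right, ← Multiset.sum_map_add]
    refine congrArg Multiset.sum (Multiset.map_congr rfl fun y hy => ?_)
    rw [sum_map_eq_add_confDel _ hy, cons_confDel hy]
    ring
  rw [hlower, hraise, hdiag, kzero]
  ring
end
end

section
/- Let E be a measurable space and let P be a Markov kernel from Conf(E) to Conf(E) that is consistent, i.e., for every measurable f : Conf(E) → [0,∞] and every finite configuration η, ∫ (𝒜f)(ξ) P(η, dξ) = ∑_{x∈η} (∫ f(ξ) P(η − x, dξ)), where (𝒜f)(η) := ∑_{x∈η} f(η − x). Then P is conservative: for every finite configuration η, P(η, {ξ : |ξ| = |η|}) = 1. In particular, every consistent Markov semigroup (P_t)_{t≥0} on Conf(E) is conservative. -/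
open MeasureTheory ProbabilityTheory
open scoped ENNReal

noncomputable section

variable {E : Type*}

/-- The annihilation operator `(𝒜f)(η) = ∑_{x∈η} f(η − x)`. -/
def annih (f : Multiset E → ℝ≥0∞) (η : Multiset E) : ℝ≥0∞ :=
  (η.map (fun x => f (confDel η x))).sum

theorem card_confDel {η : Multiset E} {x : E} (hx : x ∈ η) :
    Multiset.card (confDel η x) = Multiset.card η - 1 := by
  classical
  unfold confDel
  rw [Multiset.card_erase_of_mem hx]
  rfl

theorem measurableSet_card_eq [MeasurableSpace E] (n : ℕ) :
    MeasurableSet {ξ : Multiset E | Multiset.card ξ = n} := by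
  refine MeasurableSpace.measurableSet_generateFrom ⟨Set.univ, n, MeasurableSet.univ, ?_⟩
  ext ξ
  have h : confCount ξ Set.univ = Multiset.card ξ := by
    unfold confCount
    exact (@Multiset.countP_eq_card E _ (Classical.decPred _) ξ).2 fun _ _ => Set.mem_univ _
  simp [h]

theorem measurable_multiset_card [MeasurableSpace E] :
    Measurable (fun ξ : Multiset E => Multiset.card ξ) :=
  measurable_to_countable' fun n => measurableSet_card_eq n

/-- The annihilation operator on a function of the number of points only. -/
theorem annih_comp_card (g : ℕ → ℝ≥0∞) (ξ : Multiset E) :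
    annih (fun ζ => g (Multiset.card ζ)) ξ = Multiset.card ξ * g (Multiset.card ξ - 1) := by
  unfold annih
  have h : ξ.map (fun x => g (Multiset.card (confDel ξ x)))
      = ξ.map (fun _ => g (Multiset.card ξ - 1)) :=
    Multiset.map_congr rfl fun x hx => by rw [card_confDel hx]
  rw [h, Multiset.map_const', Multiset.sum_replicate, nsmul_eq_mul]

/-- a consistent Markov kernel on the configuration space is conservative. -/
theorem consistent_implies_conservative [MeasurableSpace E]
    (P : Kernel (Multiset E) (Multiset E)) [IsMarkovKernel P]
    (hcons : ∀ f : Multiset E → ℝ≥0∞, Measurable f → ∀ η : Multiset E,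
      ∫⁻ ξ, annih f ξ ∂(P η) = (η.map (fun x => ∫⁻ ξ, f ξ ∂(P (confDel η x)))).sum) :
    ∀ η : Multiset E, P η {ξ | Multiset.card ξ = Multiset.card η} = 1 := by
  intro η
  induction hn : Multiset.card η generalizing η with
  | zero =>
    have h := hcons (fun _ => 1) measurable_const η
    rw [Multiset.card_eq_zero.1 hn] at h ⊢
    simp only [annih_comp_card (fun _ => 1), mul_one, Multiset.map_zero, Multiset.sum_zero] at h
    have hmeas : Measurable fun ξ : Multiset E => (Multiset.card ξ : ℝ≥0∞) :=
      (measurable_of_countable fun m : ℕ => (m : ℝ≥0∞)).comp measurable_multiset_card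
    rw [lintegral_eq_zero_iff hmeas] at h
    rw [← mem_ae_iff_prob_eq_one (measurableSet_card_eq 0)]
    filter_upwards [h] with ξ hξ
    exact Nat.cast_eq_zero.1 hξ
  | succ n ih =>
    have h := hcons (fun ξ => if Multiset.card ξ = n then 1 else 0)
      ((measurable_of_countable fun m : ℕ => if m = n then (1 : ℝ≥0∞) else 0).comp
        measurable_multiset_card) η
    have hind : ∀ (k : ℕ) (ζ : Multiset E),
        ∫⁻ ξ, (if Multiset.card ξ = k then 1 else 0) ∂(P ζ)
          = P ζ {ξ | Multiset.card ξ = k} := by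
      intro k ζ
      rw [← lintegral_indicator_one (measurableSet_card_eq k)]
      simp [Set.indicator_apply]
    have hann : ∀ ξ : Multiset E,
        annih (fun ζ => if Multiset.card ζ = n then 1 else 0) ξ
          = (n + 1 : ℕ) * (if Multiset.card ξ = n + 1 then 1 else 0) := by
      intro ξ
      rw [annih_comp_card (fun m => if m = n then 1 else 0)]
      cases Multiset.card ξ with
      | zero => simp
      | succ m => by_cases hm : m = n <;> simp [hm]
    have hmap : η.map (fun x => P (confDel η x) {ξ | Multiset.card ξ = n})
        = η.map (fun _ => 1) :=
      Multiset.map_congr rfl fun x hx => ih _ (by rw [card_confDel hx, hn, Nat.add_sub_cancel])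
    simp_rw [hann, hind] at h
    rw [lintegral_const_mul' _ _ (ENNReal.natCast_ne_top _), hind, hmap, Multiset.map_const',
      Multiset.sum_replicate, hn, nsmul_eq_mul] at h
    exact (ENNReal.mul_right_inj (Nat.cast_ne_zero.2 n.succ_ne_zero)
      (ENNReal.natCast_ne_top _)).1 h
end
end

section
/- Let a > 0, p ∈ (0,1), and x ∈ ℕ. Define the Meixner polynomial value M_n(x; a, p) := ∑_{k=0}^{n} ((−x)_k (−n)_k / ((a)_k · k!)) (1 − 1/p)^k for n ∈ ℕ, where (c)_k = c(c+1)⋯(c+k−1) is the rising factorial (of the real number c). Then for every real t with |t| < 1, the series ∑_{n=0}^∞ ((a)_n / n!) t^n M_n(x; a, p) converges absolutely and equals (1 − t/p)^x · (1 − t)^{−a−x}, where (1−t)^{−a−x} denotes the real power rpow. -/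
noncomputable section

/-- The rising factorial `(c)_k = c (c+1) ⋯ (c+k−1)` of a real number. -/
def risingFactorial (c : ℝ) (k : ℕ) : ℝ :=
  ∏ i ∈ Finset.range k, (c + i)

/-- The Meixner polynomial `M_n(x; a, p)` evaluated at `x ∈ ℕ`. -/
def meixner (a p : ℝ) (x : ℕ) (n : ℕ) : ℝ :=
  ∑ k ∈ Finset.range (n + 1),
    risingFactorial (-(x : ℝ)) k * risingFactorial (-(n : ℝ)) k /
      (risingFactorial a k * (Nat.factorial k)) * (1 - 1 / p) ^ k

theorem risingFactorial_succ (c : ℝ) (k : ℕ) :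
    risingFactorial c (k + 1) = risingFactorial c k * (c + k) :=
  Finset.prod_range_succ _ _

theorem risingFactorial_add (c : ℝ) (k m : ℕ) :
    risingFactorial c (k + m) = risingFactorial c k * risingFactorial (c + k) m := by
  simp [risingFactorial, Finset.prod_range_add, add_assoc]

theorem risingFactorial_pos {c : ℝ} (hc : 0 < c) (k : ℕ) : 0 < risingFactorial c k :=
  Finset.prod_pos fun i _ => by positivity

theorem risingFactorial_eq_ascPochhammer_eval (c : ℝ) (k : ℕ) :
    risingFactorial c k = (ascPochhammer ℝ k).eval c := by
  induction k with
  | zero => simp [risingFactorial]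
  | succ k ih => rw [risingFactorial_succ, ascPochhammer_succ_eval, ih]

theorem risingFactorial_neg_natCast (n k : ℕ) :
    risingFactorial (-(n : ℝ)) k = (-1) ^ k * n.descFactorial k := by
  rw [risingFactorial_eq_ascPochhammer_eval, ascPochhammer_eval_neg_eq_descPochhammer,
    descPochhammer_eval_eq_descFactorial]

theorem risingFactorial_div_factorial (c : ℝ) (n : ℕ) :
    risingFactorial c n / n.factorial = Ring.choose (c + n - 1) n := by
  rw [← Ring.multichoose_eq, risingFactorial_eq_ascPochhammer_eval,
    ← Polynomial.ascPochhammer_smeval_eq_eval, ← Ring.factorial_nsmul_multichoose_eq_ascPochhammer,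
    nsmul_eq_mul, mul_div_cancel_left₀ _ (by positivity)]

/-- The binomial series for `(1 - t) ^ (-c)`. -/
theorem hasSum_risingFactorial_div_factorial_mul_pow (c : ℝ) {t : ℝ} (ht : |t| < 1) :
    HasSum (fun n : ℕ => risingFactorial c n / n.factorial * t ^ n) ((1 - t) ^ (-c)) := by
  have h := (Real.one_div_one_sub_rpow_hasFPowerSeriesOnBall_zero c).hasSum (y := t)
    (by simpa [enorm_eq_nnnorm, ← NNReal.coe_lt_coe] using ht)
  have h1 : 0 ≤ 1 - t := by linarith [(abs_lt.mp ht).2]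
  simpa [risingFactorial_div_factorial, Real.rpow_neg h1, mul_comm] using h

theorem meixner_eq_sum_range (a p : ℝ) (x n : ℕ) :
    meixner a p x n = ∑ k ∈ Finset.range (x + 1),
      risingFactorial (-(x : ℝ)) k * risingFactorial (-(n : ℝ)) k /
        (risingFactorial a k * k.factorial) * (1 - 1 / p) ^ k := by
  have key : ∀ N k : ℕ, k ∉ Finset.range (N + 1) → risingFactorial (-(N : ℝ)) k = 0 := by
    intro N k hk
    have hk : N < k := by rwa [Finset.mem_range, not_lt, Nat.succ_le_iff] at hk
    simp [risingFactorial_neg_natCast, Nat.descFactorial_of_lt hk]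
  rw [meixner]
  rcases le_total n x with h | h
  · exact Finset.sum_subset (Finset.range_subset_range.2 (by lia))
      fun k _ hk => by simp [key n k hk]
  · exact (Finset.sum_subset (Finset.range_subset_range.2 (by lia))
      fun k _ hk => by simp [key x k hk]).symm

theorem hasSum_meixner_summand {a : ℝ} (ha : 0 < a) (c : ℝ) (x k : ℕ) {t : ℝ} (ht : |t| < 1) :
    HasSum (fun n : ℕ => risingFactorial a n / n.factorial * t ^ n *
        (risingFactorial (-(x : ℝ)) k * risingFactorial (-(n : ℝ)) k /
          (risingFactorial a k * k.factorial) * c ^ k))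
      (x.choose k * (c * t) ^ k * (1 - t) ^ (-(a + k))) := by
  rw [← hasSum_nat_add_iff' k, Finset.sum_eq_zero, sub_zero]
  · convert! (hasSum_risingFactorial_div_factorial_mul_pow (a + k) ht).mul_left
      (x.choose k * (c * t) ^ k) using 2 with m
    have hf : ((m + k).factorial : ℝ) = m.factorial * (m + k).descFactorial k := by
      rw [← Nat.factorial_mul_descFactorial (Nat.le_add_left k m), Nat.add_sub_cancel, Nat.cast_mul]
    have hd : ((m + k).descFactorial k : ℝ) ≠ 0 := by
      simp [Nat.descFactorial_eq_zero_iff_lt]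
    have hs : ((-1 : ℝ) ^ k) * (-1) ^ k = 1 := by rw [← mul_pow]; simp
    have hr := (risingFactorial_pos ha k).ne'
    rw [risingFactorial_neg_natCast, risingFactorial_neg_natCast, hf, add_comm m k,
      risingFactorial_add, Nat.descFactorial_eq_factorial_mul_choose x, add_comm k m, Nat.cast_mul,
      mul_mul_mul_comm ((-1 : ℝ) ^ k), hs]
    field_simp
    ring
  · intro n hn
    simp [risingFactorial_neg_natCast, Nat.descFactorial_of_lt (Finset.mem_range.1 hn)]

theorem hasSum_meixner {a : ℝ} (ha : 0 < a) (p : ℝ) (x : ℕ) {t : ℝ} (ht : |t| < 1) :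
    HasSum (fun n : ℕ => risingFactorial a n / n.factorial * t ^ n * meixner a p x n)
      ((1 - t / p) ^ x * (1 - t) ^ (-a - (x : ℝ))) := by
  have h1 : 0 < 1 - t := by linarith [(abs_lt.mp ht).2]
  convert! hasSum_sum (s := Finset.range (x + 1)) fun k _ =>
    hasSum_meixner_summand ha (1 - 1 / p) x k ht using 1
  · ext n
    rw [meixner_eq_sum_range, Finset.mul_sum]
  · rw [show 1 - t / p = (1 - 1 / p) * t + (1 - t) by ring, add_pow, Finset.sum_mul]
    refine Finset.sum_congr rfl fun k hk => ?_
    have hk : k ≤ x := Nat.lt_succ_iff.1 (Finset.mem_range.1 hk)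
    rw [show -(a + k) = ((x - k : ℕ) : ℝ) + (-a - x) by push_cast [hk]; ring,
      Real.rpow_add h1, Real.rpow_natCast]
    ring

/-- the generating function of the Meixner polynomials,
`∑ₙ ((a)ₙ/n!) tⁿ Mₙ(x; a, p) = (1 − t/p)^x (1 − t)^{−a−x}`, with absolute convergence,
for `|t| < 1`. -/
theorem meixner_generating_function (a p : ℝ) (ha : 0 < a) (hp : p ∈ Set.Ioo (0 : ℝ) 1)
    (x : ℕ) (t : ℝ) (ht : |t| < 1) :
    Summable (fun n : ℕ => |risingFactorial a n / (Nat.factorial n) * t ^ n * meixner a p x n|)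
    ∧ ∑' n : ℕ, risingFactorial a n / (Nat.factorial n) * t ^ n * meixner a p x n
        = (1 - t / p) ^ x * (1 - t) ^ (-a - (x : ℝ)) := by
  have h := hasSum_meixner ha p x ht
  exact ⟨h.summable.abs, h.tsum_eq⟩
end
end

section
/- Let E be a type, ℓ ≥ 1, and let B₁, …, B_ℓ ⊆ E be pairwise disjoint sets. Let n₁, …, n_ℓ ∈ ℕ with n = n₁ + ⋯ + n_ℓ, and let c : Fin n → Fin ℓ be any function such that for each j the number of indices i with c(i) = j equals n_j. Then for every x : Fin n → E: (1/n!) ∑_{σ ∈ Perm(Fin n)} ∏_{i=1}^{n} 𝟙_{B_{c(i)}}(x_{σ(i)}) equals (n₁! ⋯ n_ℓ!)/n! if for every j the number of indices i with x_i ∈ B_j equals n_j, and equals 0 otherwise. (This identifies the symmetric tensor product 𝟙_{B₁}^{⊗ₛ n₁} ⊗ₛ ⋯ ⊗ₛ 𝟙_{B_ℓ}^{⊗ₛ n_ℓ} evaluated at (x₁,…,x_n).) -/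
open scoped Classical

noncomputable section

/-- For pairwise disjoint sets, belonging to `B k` determines the index `k`. -/
theorem mem_iff_eq_of_pairwise_disjoint {E ι : Type*} {B : ι → Set E}
    (hB : Pairwise (Function.onFun Disjoint B)) {y : E} {k : ι} (hy : y ∈ B k) (j : ι) :
    y ∈ B j ↔ k = j := by
  refine ⟨fun hj => ?_, fun h => h ▸ hy⟩
  by_contra hkj
  exact Set.disjoint_left.mp (hB hkj) hy hj

/-- If the number of points lying in each `B j` matches the size of the fibre of `c` over `j`,
some permutation puts the points in the sets prescribed by `c`. -/
theorem exists_perm_forall_mem {E α ι : Type*} [Finite α] {B : ι → Set E}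
    (hB : Pairwise (Function.onFun Disjoint B)) {c : α → ι} {x : α → E}
    (h : ∀ j, Nat.card {i // c i = j} = Nat.card {i // x i ∈ B j}) :
    ∃ σ : Equiv.Perm α, ∀ i, x (σ i) ∈ B (c i) := by
  let e : ∀ j, {i // c i = j} ≃ {i // x i ∈ B j} := fun j =>
    (Finite.equivFinOfCardEq (h j)).trans (Finite.equivFin _).symm
  let f : α → α := fun i => (e (c i) ⟨i, rfl⟩).val
  have hf : ∀ i, x (f i) ∈ B (c i) := fun i => (e (c i) ⟨i, rfl⟩).2
  have hfe : ∀ i j (hij : c i = j), f i = (e j ⟨i, hij⟩).val := by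
    rintro i _ rfl
    rfl
  have hinj : Function.Injective f := by
    intro i i' hii
    have hc : c i = c i' := (mem_iff_eq_of_pairwise_disjoint hB (hf i) _).mp (hii ▸ hf i')
    rw [hfe i _ hc, hfe i' _ rfl] at hii
    exact congrArg Subtype.val ((e (c i')).injective (Subtype.ext hii))
  exact ⟨Equiv.ofBijective f (Finite.injective_iff_bijective.mp hinj), hf⟩

/-- If `σ₀` puts the points in the sets prescribed by `c`, the permutations doing so form a coset
of the stabilizer of `c`. -/
theorem card_perm_forall_mem {E α ι : Type*} [Finite α] [Fintype ι]
    {B : ι → Set E}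
    (hB : Pairwise (Function.onFun Disjoint B)) {c : α → ι} {x : α → E}
    {σ₀ : Equiv.Perm α} (hσ₀ : ∀ i, x (σ₀ i) ∈ B (c i)) :
    Nat.card {σ : Equiv.Perm α // ∀ i, x (σ i) ∈ B (c i)} =
      ∏ j, (Nat.card {i // c i = j}).factorial := by
  have hstab : Nat.card {σ : Equiv.Perm α // c ∘ σ = c} =
      ∏ j, (Nat.card {i // c i = j}).factorial :=
    DomMulAct.stabilizer_ncard c
  rw [← hstab]
  refine (Nat.card_congr ((Equiv.mulLeft σ₀).subtypeEquiv fun σ => ?_)).symm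
  rw [funext_iff]
  exact forall_congr' fun i => (mem_iff_eq_of_pairwise_disjoint hB (hσ₀ (σ i)) (c i)).symm

/-- If `σ₀` puts the points in the sets prescribed by `c`, then each `B j` contains as many points
as the fibre of `c` over `j` has elements. -/
theorem card_mem_eq_card_fiber {E α ι : Type*} {B : ι → Set E}
    (hB : Pairwise (Function.onFun Disjoint B)) {c : α → ι} {x : α → E}
    {σ₀ : Equiv.Perm α} (hσ₀ : ∀ i, x (σ₀ i) ∈ B (c i)) (j : ι) :
    Nat.card {i // x i ∈ B j} = Nat.card {i // c i = j} :=
  (Nat.card_congr (σ₀.subtypeEquiv fun i =>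
    (mem_iff_eq_of_pairwise_disjoint hB (hσ₀ i) j).symm)).symm

/-- The sum over permutations of the products of indicators counts the permutations that put the
points in the sets prescribed by `c`. -/
theorem sum_perm_prod_indicator {E α ι : Type*} [Fintype α] [DecidableEq α]
    (B : ι → Set E) (c : α → ι) (x : α → E) :
    ∑ σ : Equiv.Perm α, ∏ i, (B (c i)).indicator (fun _ => (1 : ℝ)) (x (σ i)) =
      Nat.card {σ : Equiv.Perm α // ∀ i, x (σ i) ∈ B (c i)} := by
  simp only [Set.indicator_apply, Finset.prod_ite_zero, Finset.prod_const_one, Finset.mem_univ,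
    true_imp_iff, Finset.sum_boole, Nat.card_eq_fintype_card, Fintype.card_subtype]

/-- evaluation of the symmetric tensor product of indicators
`𝟙_{B₁}^{⊗ₛn₁} ⊗ₛ ⋯ ⊗ₛ 𝟙_{B_ℓ}^{⊗ₛn_ℓ}`. -/
theorem symmetric_tensor_indicator {E : Type*} (ℓ : ℕ) (hℓ : 1 ≤ ℓ)
    (B : Fin ℓ → Set E) (hB : Pairwise (Function.onFun Disjoint B))
    (n : Fin ℓ → ℕ) (N : ℕ) (hN : N = ∑ j, n j)
    (c : Fin N → Fin ℓ)
    (hc : ∀ j, (Finset.univ.filter (fun i => c i = j)).card = n j)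
    (x : Fin N → E) :
    (1 / (Nat.factorial N : ℝ)) *
        ∑ σ : Equiv.Perm (Fin N), ∏ i, (B (c i)).indicator (fun _ => (1 : ℝ)) (x (σ i))
      = if ∀ j, (Finset.univ.filter (fun i => x i ∈ B j)).card = n j
        then (∏ j, (Nat.factorial (n j) : ℝ)) / (Nat.factorial N : ℝ)
        else 0 := by
  have hfib : ∀ j, Nat.card {i // c i = j} = n j := fun j => by
    rw [← hc j, Nat.card_eq_fintype_card, Fintype.card_subtype]
  simp only [← Fintype.card_subtype, ← Nat.card_eq_fintype_card]
  rw [sum_perm_prod_indicator]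
  by_cases hσ : ∃ σ : Equiv.Perm (Fin N), ∀ i, x (σ i) ∈ B (c i)
  · obtain ⟨σ₀, hσ₀⟩ := hσ
    have hcard := card_perm_forall_mem hB hσ₀
    simp only [hfib] at hcard
    rw [if_pos fun j => (card_mem_eq_card_fiber hB hσ₀ j).trans (hfib j), hcard]
    push_cast
    ring
  · have hempty : IsEmpty {σ : Equiv.Perm (Fin N) // ∀ i, x (σ i) ∈ B (c i)} :=
      ⟨fun σ => hσ ⟨σ.1, σ.2⟩⟩
    rw [if_neg fun h => hσ (exists_perm_forall_mem hB fun j => (hfib j).trans (h j).symm),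
      Nat.card_of_isEmpty]
    simp
end
end
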